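/- Let q : ℝ×ℝ → ℝ be continuously differentiable with q(·,t) and q_x(·,t) bounded for each t, and let f : ℝ×ℝ → ℝ be a real-valued function, three times continuously differentiable in x and once in t, satisfying f_t = -4 f_xxx + 6 q f_x + 3 q_x f on ℝ×ℝ. Assume that for each t the functions f(·,t), f_x(·,t), f_xx(·,t), f_xxx(·,t) are integrable on ℝ and f(x,t), f_x(x,t), f_xx(x,t) → 0 as |x| → ∞, and that on each compact time interval the product f · f_t is dominated by a t-independent integrable function of x. Then t ↦ ∫_ℝ f(x,t)² dx is constant. -/

import Mathlib

open MeasureTheory Filter Topology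

/-- Partial derivative with respect to the first (spatial) variable. -/
noncomputable def pdx (u : ℝ → ℝ → ℝ) : ℝ → ℝ → ℝ :=
  fun x t => deriv (fun x' => u x' t) x

/-- Partial derivative with respect to the second (time) variable. -/
noncomputable def pdt (u : ℝ → ℝ → ℝ) : ℝ → ℝ → ℝ :=
  fun x t => deriv (fun t' => u x t') t

/-- An integrable continuous function vanishing at `±∞` is square integrable. -/
theorem integrable_sq_of_tendsto_zero {u : ℝ → ℝ} (hu : Continuous u) (hi : Integrable u)
    (htop : Tendsto u atTop (𝓝 0)) (hbot : Tendsto u atBot (𝓝 0)) :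
    Integrable fun x => u x ^ 2 := by
  let v : ZeroAtInftyContinuousMap ℝ ℝ :=
    ⟨⟨u, hu⟩, by rw [cocompact_eq_atBot_atTop]; exact hbot.sup htop⟩
  obtain ⟨C, hC⟩ := v.isBounded_range.exists_norm_le
  simpa only [sq] using hi.bdd_mul hu.aestronglyMeasurable
    (Eventually.of_forall fun x => hC (u x) ⟨x, rfl⟩)

/-- The second Lax operator with potential `p` is formally skew-adjoint: the integral of
`2 u` times its value at `u` vanishes for decaying `u` and bounded `p`. -/
theorem integral_mul_lax_eq_zero {p u : ℝ → ℝ} {C : ℝ} (hp : ContDiff ℝ 1 p)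
    (hpb : ∀ x, |p x| ≤ C) (hu : ContDiff ℝ 3 u)
    (hdecay : ∀ l ∈ ({atTop, atBot} : Set (Filter ℝ)), Tendsto u l (𝓝 0) ∧
      Tendsto (deriv u) l (𝓝 0) ∧ Tendsto (deriv (deriv u)) l (𝓝 0))
    (hi : Integrable fun x => 2 * (u x *
      (-4 * deriv (deriv (deriv u)) x + 6 * p x * deriv u x + 3 * deriv p x * u x))) :
    ∫ x, 2 * (u x *
      (-4 * deriv (deriv (deriv u)) x + 6 * p x * deriv u x + 3 * deriv p x * u x)) = 0 := by
  have hu1 : ContDiff ℝ 2 (deriv u) := ContDiff.deriv' hu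
  have hu2 : ContDiff ℝ 1 (deriv (deriv u)) := ContDiff.deriv' hu1
  have hlim : ∀ l ∈ ({atTop, atBot} : Set (Filter ℝ)), Tendsto
      (fun x => -8 * (u x * deriv (deriv u) x) + 4 * deriv u x ^ 2 + 6 * (p x * u x ^ 2))
      l (𝓝 0) := by
    intro l hl
    obtain ⟨h0, h1, h2⟩ := hdecay l hl
    have hpu : Tendsto (fun x => p x * u x ^ 2) l (𝓝 0) :=
      bdd_le_mul_tendsto_zero' C (Eventually.of_forall hpb) (by simpa using h0.pow 2)
    simpa using (((h0.mul h2).const_mul (-8)).add ((h1.pow 2).const_mul 4)).add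
      (hpu.const_mul 6)
  have hderiv : ∀ x, HasDerivAt
      (fun x => -8 * (u x * deriv (deriv u) x) + 4 * deriv u x ^ 2 + 6 * (p x * u x ^ 2))
      (2 * (u x *
        (-4 * deriv (deriv (deriv u)) x + 6 * p x * deriv u x + 3 * deriv p x * u x))) x := by
    intro x
    have d0 := (hu.differentiable (by norm_num) x).hasDerivAt
    have d1 := (hu1.differentiable (by norm_num) x).hasDerivAt
    have d2 := (hu2.differentiable (by norm_num) x).hasDerivAt
    have dp := (hp.differentiable (by norm_num) x).hasDerivAt
    refine ((((d0.mul d2).const_mul (-8)).add ((d1.pow 2).const_mul 4)).add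
      ((dp.mul (d0.pow 2)).const_mul 6)).congr_deriv ?_
    simp only [Pi.pow_apply]
    ring
  simpa using integral_of_hasDerivAt_of_tendsto hderiv hi (hlim atBot (by simp))
    (hlim atTop (by simp))

theorem statement10 (q f : ℝ → ℝ → ℝ)
    (hq : ContDiff ℝ 1 fun p : ℝ × ℝ => q p.1 p.2)
    (hqb : ∀ t, ∃ C, ∀ x, |q x t| ≤ C ∧ |pdx q x t| ≤ C)
    (hfx : ∀ t, ContDiff ℝ 3 fun x => f x t)
    (hft : ∀ x, ContDiff ℝ 1 fun t => f x t)
    (heq : ∀ x t, pdt f x t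
      = -4 * pdx (pdx (pdx f)) x t + 6 * q x t * pdx f x t + 3 * pdx q x t * f x t)
    (hint : ∀ t, Integrable (fun x => f x t) ∧ Integrable (fun x => pdx f x t) ∧
      Integrable (fun x => pdx (pdx f) x t) ∧ Integrable (fun x => pdx (pdx (pdx f)) x t))
    (hdecay : ∀ t,
      Tendsto (fun x => f x t) atTop (𝓝 0) ∧ Tendsto (fun x => f x t) atBot (𝓝 0) ∧
      Tendsto (fun x => pdx f x t) atTop (𝓝 0) ∧ Tendsto (fun x => pdx f x t) atBot (𝓝 0) ∧
      Tendsto (fun x => pdx (pdx f) x t) atTop (𝓝 0) ∧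
      Tendsto (fun x => pdx (pdx f) x t) atBot (𝓝 0))
    (hdom : ∀ a b : ℝ, ∃ g : ℝ → ℝ, Integrable g ∧
      ∀ t ∈ Set.Icc a b, ∀ x, |f x t * pdt f x t| ≤ g x) :
    ∀ t t', ∫ x, (f x t) ^ 2 = ∫ x, (f x t') ^ 2 := by
  have hqx : ∀ t, ContDiff ℝ 1 fun x => q x t := fun t =>
    hq.comp (contDiff_id.prodMk contDiff_const)
  have hcont : ∀ t, Continuous fun x => pdt f x t := by
    intro t
    have hf1 : ContDiff ℝ 2 fun x => pdx f x t := ContDiff.deriv' (hfx t)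
    have hf2 : ContDiff ℝ 1 fun x => pdx (pdx f) x t := ContDiff.deriv' hf1
    have hf3 : Continuous fun x => pdx (pdx (pdx f)) x t := hf2.continuous_deriv le_rfl
    have hq1 : Continuous fun x => pdx q x t := (hqx t).continuous_deriv le_rfl
    simp only [heq]
    exact ((continuous_const.mul hf3).add
      ((continuous_const.mul (hqx t).continuous).mul hf1.continuous)).add
      ((continuous_const.mul hq1).mul (hfx t).continuous)
  have key : ∀ t, HasDerivAt (fun s => ∫ x, (f x s) ^ 2) 0 t := by
    intro t
    obtain ⟨g, hg, hfg⟩ := hdom (t - 1) (t + 1)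
    obtain ⟨h0t, h0b, h1t, h1b, h2t, h2b⟩ := hdecay t
    obtain ⟨C, hC⟩ := hqb t
    obtain ⟨hI, hD⟩ := hasDerivAt_integral_of_dominated_loc_of_deriv_le (μ := volume)
      (F := fun s x => (f x s) ^ 2) (F' := fun s x => 2 * (f x s * pdt f x s))
      (bound := fun x => 2 * g x)
      (Icc_mem_nhds (by linarith : t - 1 < t) (by linarith : t < t + 1))
      (Eventually.of_forall fun s => ((hfx s).continuous.pow 2).aestronglyMeasurable)
      (integrable_sq_of_tendsto_zero (hfx t).continuous (hint t).1 h0t h0b)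
      (continuous_const.mul ((hfx t).continuous.mul (hcont t))).aestronglyMeasurable
      (Eventually.of_forall fun x s hs => by
        rw [Real.norm_eq_abs, abs_mul, abs_two]
        exact mul_le_mul_of_nonneg_left (hfg s hs x) zero_le_two)
      (hg.const_mul 2)
      (Eventually.of_forall fun x s _ => by
        refine (((hft x).differentiable one_ne_zero s).hasDerivAt.pow 2).congr_deriv ?_
        simp only [pdt]
        ring)
    simp only [heq] at hI hD
    have hzero := integral_mul_lax_eq_zero (hqx t) (fun x => (hC x).1) (hfx t)
      (by rintro l (rfl | rfl); exacts [⟨h0t, h1t, h2t⟩, ⟨h0b, h1b, h2b⟩]) hI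
    exact hzero ▸ hD
  exact is_const_of_deriv_eq_zero (fun t => (key t).differentiableAt) fun t => (key t).deriv
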